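/- Let μ be a probability measure on ℝ with mean 0 and variance σ² ∈ (0,∞). If ν and ν′ are probability measures on ℝ such that for all w ∈ ℂ₊ both w·G_μ(w) − 1 = σ² · G_μ(w) · G_ν(1/G_μ(w)) and w·G_μ(w) − 1 = σ² · G_μ(w) · G_{ν′}(1/G_μ(w)) hold, then ν = ν′. That is, the Lévy measure of μ in the free Lévy–Khintchine relation is uniquely determined by μ. -/

import Mathlib

open MeasureTheory Complex

/-- The Cauchy transform of a measure on ℝ. -/
noncomputable def cauchy (μ : Measure ℝ) (z : ℂ) : ℂ := ∫ t, (z - (t : ℂ))⁻¹ ∂μ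

lemma cauchy_eq_rt (μ : Measure ℝ) : cauchy μ = fun z => - resolventTransform μ z := by
  funext z
  rw [cauchy, resolventTransform_apply, ← integral_neg]
  congr 1
  funext t
  rw [resolvent, Ring.inverse_eq_inv', ← inv_neg]
  simp

lemma cauchy_diff (μ : Measure ℝ) [IsFiniteMeasure μ] :
    DifferentiableOn ℂ (cauchy μ) {z | 0 < z.im} := by
  rw [cauchy_eq_rt]
  intro z hz
  have : z ∉ algebraMap ℝ ℂ '' μ.support := by
    rintro ⟨x, -, rfl⟩
    simp at hz
  exact (hasDerivAt_resolventTransform z this).differentiableAt.neg.differentiableWithinAt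

lemma cauchy_integrable (μ : Measure ℝ) [IsFiniteMeasure μ] (z : ℂ) (hz : 0 < z.im) :
    Integrable (fun t : ℝ => (z - (t : ℂ))⁻¹) μ := by
  refine Integrable.of_bound (C := (z.im)⁻¹) ?_ ?_
  · refine Measurable.aestronglyMeasurable ?_
    fun_prop
  · filter_upwards with t
    rw [norm_inv]
    gcongr
    have := Complex.abs_im_le_norm (z - (t : ℂ))
    simp only [sub_im, ofReal_im, sub_zero] at this
    exact (le_abs_self _).trans this

lemma cauchy_im (μ : Measure ℝ) [IsFiniteMeasure μ] (x y : ℝ) (hy : 0 < y) :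
    (cauchy μ (x + y * I)).im = - ∫ t, y / ((x - t) ^ 2 + y ^ 2) ∂μ := by
  have h := cauchy_integrable μ (x + y * I) (by simpa using hy)
  have := Complex.imCLM.integral_comp_comm h
  rw [cauchy]
  simp only [Complex.imCLM_apply] at this
  rw [← this, ← integral_neg]
  congr 1
  funext t
  rw [Complex.inv_im, Complex.normSq_apply]
  simp
  ring

lemma cauchy_im_neg (μ : Measure ℝ) [IsProbabilityMeasure μ] (z : ℂ) (hz : 0 < z.im) :
    (cauchy μ z).im < 0 := by
  have h := cauchy_im μ z.re z.im hz
  rw [Complex.re_add_im] at h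
  rw [h, neg_lt_zero]
  have hpos : ∀ t : ℝ, 0 < z.im / ((z.re - t) ^ 2 + z.im ^ 2) := fun t => by positivity
  rw [integral_pos_iff_support_of_nonneg (fun t => (hpos t).le)]
  · have : Function.support (fun t : ℝ => z.im / ((z.re - t) ^ 2 + z.im ^ 2)) = Set.univ := by
      ext t; simpa using (hpos t).ne'
    rw [this]; simp
  · refine Integrable.of_bound (C := (z.im)⁻¹) ?_ ?_
    · exact Measurable.aestronglyMeasurable (by fun_prop)
    · filter_upwards with t
      rw [Real.norm_of_nonneg (hpos t).le, inv_eq_one_div, div_le_div_iff₀ (by positivity) hz]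
      nlinarith [sq_nonneg (z.re - t)]


lemma poisson_fubini' (ν : Measure ℝ) [IsProbabilityMeasure ν] (f : ℝ → ℝ) (hf : Continuous f)
    (hfi : Integrable f) (y : ℝ) (hy : 0 < y) :
    ∫ x, f x * (-(cauchy ν (x + y * I)).im) = ∫ t, (∫ u, f (t + y * u) * (1 + u ^ 2)⁻¹) ∂ν := by
  have h1 : ∀ x : ℝ, f x * (-(cauchy ν (x + y * I)).im)
      = ∫ t, f x * (y / ((x - t) ^ 2 + y ^ 2)) ∂ν := fun x => by
    rw [cauchy_im ν x y hy, neg_neg, integral_const_mul]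
  simp_rw [h1]
  rw [integral_integral_swap]
  · congr 1
    funext t
    have h2 : ∀ u : ℝ, f (t + y * u) * (1 + u ^ 2)⁻¹
        = y * (fun x => f x * (y / ((x - t) ^ 2 + y ^ 2))) (t + y * u) := fun u => by
      have : (1 + u ^ 2) ≠ 0 := by positivity
      have : ((t + y * u - t) ^ 2 + y ^ 2) = y ^ 2 * (1 + u ^ 2) := by ring
      simp only [this]
      field_simp
    simp_rw [h2]
    rw [integral_const_mul,
      Measure.integral_comp_mul_left (fun s => (fun x => f x * (y / ((x - t) ^ 2 + y ^ 2))) (t + s)) y,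
      integral_add_left_eq_self (fun x => f x * (y / ((x - t) ^ 2 + y ^ 2)))]
    rw [abs_of_pos (by positivity), smul_eq_mul, mul_inv_cancel_left₀ hy.ne']
  · have h3 : Integrable (fun p : ℝ × ℝ => f p.1 * (1 : ℝ)) (volume.prod ν) :=
      hfi.mul_prod (integrable_const (1 : ℝ))
    have := h3.bdd_mul (c := y⁻¹) (f := fun p : ℝ × ℝ => (y / ((p.1 - p.2) ^ 2 + y ^ 2))) 
      (Measurable.aestronglyMeasurable (by fun_prop)) (by
        filter_upwards with p
        rw [Real.norm_of_nonneg (by positivity), inv_eq_one_div, div_le_div_iff₀ (by positivity) hy]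
        nlinarith [sq_nonneg (p.1 - p.2)])
    refine this.congr ?_
    filter_upwards with p
    simp [Function.uncurry]
    ring

lemma poisson_tendsto (ν : Measure ℝ) [IsProbabilityMeasure ν] (f : ℝ → ℝ) (hf : Continuous f)
    (C : ℝ) (hC : ∀ x, ‖f x‖ ≤ C) :
    Filter.Tendsto (fun y : ℝ => ∫ t, (∫ u, f (t + y * u) * (1 + u ^ 2)⁻¹) ∂ν)
      (nhdsWithin 0 (Set.Ioi 0)) (nhds ((∫ t, f t ∂ν) * Real.pi)) := by
  have hP : Integrable (fun p : ℝ × ℝ => (1 : ℝ) * (1 + p.2 ^ 2)⁻¹) (ν.prod volume) :=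
    (integrable_const (1 : ℝ)).mul_prod integrable_inv_one_add_sq
  have hI : ∀ y : ℝ, Integrable (fun p : ℝ × ℝ => f (p.1 + y * p.2) * (1 + p.2 ^ 2)⁻¹)
      (ν.prod volume) := fun y => by
    have := hP.bdd_mul (c := C) (f := fun p : ℝ × ℝ => f (p.1 + y * p.2))
      (Continuous.aestronglyMeasurable (by fun_prop)) (by filter_upwards with p; exact hC _)
    simpa using this
  have h1 : ∀ y : ℝ, ∫ t, (∫ u, f (t + y * u) * (1 + u ^ 2)⁻¹) ∂ν
      = ∫ p, f (p.1 + y * p.2) * (1 + p.2 ^ 2)⁻¹ ∂(ν.prod volume) := fun y => by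
    rw [integral_prod _ (hI y)]
  have h0 : (∫ t, f t ∂ν) * Real.pi
      = ∫ p, f (p.1 + 0 * p.2) * (1 + p.2 ^ 2)⁻¹ ∂(ν.prod volume) := by
    rw [← h1]
    simp only [zero_mul, add_zero]
    simp_rw [integral_const_mul, integral_univ_inv_one_add_sq]
    rw [integral_mul_const]
  simp_rw [h1]
  rw [h0]
  refine tendsto_integral_filter_of_dominated_convergence
    (fun p => C * (1 * (1 + p.2 ^ 2)⁻¹)) ?_ ?_ (hP.const_mul C) ?_
  · exact Filter.Eventually.of_forall fun y => (hI y).1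
  · refine Filter.Eventually.of_forall fun y => ?_
    filter_upwards with p
    rw [norm_mul, Real.norm_of_nonneg (r := (1 + p.2 ^ 2)⁻¹) (by positivity) , one_mul]
    gcongr
    exact hC _
  · filter_upwards with p
    have : Continuous (fun y : ℝ => f (p.1 + y * p.2) * (1 + p.2 ^ 2)⁻¹) := by fun_prop
    exact (this.tendsto 0).mono_left nhdsWithin_le_nhds

lemma cauchy_inj (ν ν' : Measure ℝ) [IsProbabilityMeasure ν] [IsProbabilityMeasure ν']
    (h : ∀ z : ℂ, 0 < z.im → cauchy ν z = cauchy ν' z) : ν = ν' := by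
  refine Measure.ext_of_integral_eq_on_compactlySupported fun f => ?_
  obtain ⟨C, hC⟩ := f.hasCompactSupport.exists_bound_of_continuous f.continuous
  have hfi : Integrable (f : ℝ → ℝ) := f.continuous.integrable_of_hasCompactSupport f.hasCompactSupport
  have t1 := poisson_tendsto ν f f.continuous C hC
  have t2 := poisson_tendsto ν' f f.continuous C hC
  have : (∫ t, f t ∂ν) * Real.pi = (∫ t, f t ∂ν') * Real.pi := by
    refine tendsto_nhds_unique_of_eventuallyEq t1 t2 ?_
    filter_upwards [self_mem_nhdsWithin] with y hy
    have hy : 0 < y := hy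
    rw [← poisson_fubini' ν f f.continuous hfi y hy, ← poisson_fubini' ν' f f.continuous hfi y hy]
    congr 1
    funext x
    rw [h _ (by simpa using hy)]
  exact mul_right_cancel₀ Real.pi_ne_zero this

/-- the Lévy measure in the free Lévy–Khintchine relation is unique:
if ν and ν′ both satisfy w·G_μ(w) − 1 = σ²·G_μ(w)·G_ν(1/G_μ(w)) on ℂ₊ for a probability
measure μ of mean 0 and variance σ² ∈ (0,∞), then ν = ν′. -/
theorem free_Levy_measure_unique (μ ν ν' : Measure ℝ)
    [IsProbabilityMeasure μ] [IsProbabilityMeasure ν] [IsProbabilityMeasure ν']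
    (h1 : Integrable (fun t => t) μ) (hmean : (∫ t, t ∂μ) = 0)
    (h2 : Integrable (fun t => t ^ 2) μ) (hpos : 0 < ∫ t, t ^ 2 ∂μ)
    (hν : ∀ w : ℂ, 0 < w.im →
      w * cauchy μ w - 1
        = ((∫ t, t ^ 2 ∂μ : ℝ) : ℂ) * cauchy μ w * cauchy ν (cauchy μ w)⁻¹)
    (hν' : ∀ w : ℂ, 0 < w.im →
      w * cauchy μ w - 1
        = ((∫ t, t ^ 2 ∂μ : ℝ) : ℂ) * cauchy μ w * cauchy ν' (cauchy μ w)⁻¹) :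
    ν = ν' := by
  have hUo : IsOpen {z : ℂ | 0 < z.im} := isOpen_lt continuous_const Complex.continuous_im
  have hUc : IsPreconnected {z : ℂ | 0 < z.im} := (convex_halfSpace_im_gt 0).isPreconnected
  have hne : ∀ w : ℂ, 0 < w.im → cauchy μ w ≠ 0 := fun w hw h0 => by
    have := cauchy_im_neg μ w hw
    simp [h0] at this
  have hF : ∀ w : ℂ, 0 < w.im → 0 < ((cauchy μ w)⁻¹).im := fun w hw => by
    rw [Complex.inv_im]
    exact div_pos (neg_pos.2 (cauchy_im_neg μ w hw)) (Complex.normSq_pos.2 (hne w hw))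
  have hFa : AnalyticOnNhd ℂ (fun w => (cauchy μ w)⁻¹) {z : ℂ | 0 < z.im} :=
    ((cauchy_diff μ).inv hne).analyticOnNhd hUo
  have hI : (0 : ℝ) < (I : ℂ).im := by simp
  have heq : ∀ w : ℂ, 0 < w.im → cauchy ν (cauchy μ w)⁻¹ = cauchy ν' (cauchy μ w)⁻¹ := fun w hw => by
    have h := (hν w hw).symm.trans (hν' w hw)
    refine mul_left_cancel₀ (mul_ne_zero ?_ (hne w hw)) h
    exact_mod_cast hpos.ne'
  refine cauchy_inj ν ν' ?_
  rcases hFa.is_constant_or_isOpen hUc with ⟨c, hc⟩ | hop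
  · exfalso
    have h2I : (0 : ℝ) < (2 * I : ℂ).im := by simp
    have e1 := hc I hI
    have e2 := hc (2 * I) h2I
    have e : cauchy μ (2 * I) = cauchy μ I := inv_injective (e2.trans e1.symm)
    have a1 := hν I hI
    have a2 := hν (2 * I) h2I
    rw [e, ← a1] at a2
    have : I * cauchy μ I = 0 := by linear_combination a2
    rcases mul_eq_zero.1 this with h | h
    · exact Complex.I_ne_zero h
    · exact hne I hI h
  · have ho := hop _ subset_rfl hUo
    have := ((cauchy_diff ν).analyticOnNhd hUo).eqOn_of_preconnected_of_eventuallyEq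
      ((cauchy_diff ν').analyticOnNhd hUo) hUc (z₀ := (cauchy μ I)⁻¹) (hF I hI) (by
        filter_upwards [ho.mem_nhds ⟨I, hI, rfl⟩]
        rintro _ ⟨w, hw, rfl⟩
        exact heq w hw)
    exact fun z hz => this hz
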